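/- Let k be a field, let R1 and R2 be commutative noetherian k-algebras, let N1 be a finitely generated R1-module, N2 a finitely generated R2-module, and let M1 be an R1-module and M2 an R2-module. Then for every n ≥ 0 there is an isomorphism of k-vector spaces Ext^n_{R1 ⊗_k R2}(N1 ⊗_k N2, M1 ⊗_k M2) ≅ ⊕_{p+q=n} Ext^p_{R1}(N1, M1) ⊗_k Ext^q_{R2}(N2, M2). -/

import Mathlib

open TensorProduct CategoryTheory

section TensorModule

variable (k : Type) [CommRing k] (R1 R2 : Type) [CommRing R1] [CommRing R2]
  [Algebra k R1] [Algebra k R2]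
variable (M1 M2 : Type) [AddCommGroup M1] [Module k M1] [Module R1 M1] [IsScalarTower k R1 M1]
  [AddCommGroup M2] [Module k M2] [Module R2 M2] [IsScalarTower k R2 M2]

/-- The action of `R2` on `M1 ⊗[k] M2` through the right factor, as an algebra morphism
to endomorphisms. -/
noncomputable def rightSMul : R2 →ₐ[k] Module.End k (M1 ⊗[k] M2) :=
  ((Module.endTensorEndAlgHom (R := k) (S := k) (A := k) (M := M1) (N := M2)).comp
      (Algebra.TensorProduct.includeRight (R := k) (A := Module.End k M1))).comp
    (Algebra.lsmul k k M2 (A := R2))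

/-- The `R2`-module structure on `M1 ⊗[k] M2` via the right factor. -/
noncomputable def rightModule : Module R2 (M1 ⊗[k] M2) :=
  Module.compHom _ (rightSMul k R2 M1 M2).toRingHom

/-- The `R1 ⊗[k] R2`-module structure on `M1 ⊗[k] M2`, characterized by
`(r1 ⊗ r2) • (m1 ⊗ m2) = (r1 • m1) ⊗ (r2 • m2)`; see `tensorModule_smul_tmul`. -/
noncomputable instance (priority := 10) tensorModule :
    Module (R1 ⊗[k] R2) (M1 ⊗[k] M2) :=
  letI m2 : Module R2 (M1 ⊗[k] M2) := rightModule k R2 M1 M2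
  haveI t2 : IsScalarTower k R2 (M1 ⊗[k] M2) := by
    refine IsScalarTower.of_algebraMap_smul (fun r x => ?_)
    show (rightSMul k R2 M1 M2) (algebraMap k R2 r) x = r • x
    rw [AlgHom.commutes]
    simp [Module.algebraMap_end_apply]
  haveI sc : SMulCommClass R1 R2 (M1 ⊗[k] M2) := by
    constructor
    intro r1 r2 x
    show r1 • (rightSMul k R2 M1 M2 r2) x = (rightSMul k R2 M1 M2 r2) (r1 • x)
    induction x using TensorProduct.induction_on with
    | zero => simp
    | tmul m n =>
        have h1 : (rightSMul k R2 M1 M2 r2) (m ⊗ₜ[k] n) = m ⊗ₜ[k] (r2 • n) := rfl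
        have h2 : (rightSMul k R2 M1 M2 r2) ((r1 • m) ⊗ₜ[k] n) = (r1 • m) ⊗ₜ[k] (r2 • n) := rfl
        rw [h1, smul_tmul', smul_tmul', h2]
    | add x y hx hy =>
        calc r1 • (rightSMul k R2 M1 M2 r2) (x + y)
            = r1 • ((rightSMul k R2 M1 M2 r2) x + (rightSMul k R2 M1 M2 r2) y) := by
              rw [(rightSMul k R2 M1 M2 r2).map_add]
          _ = r1 • (rightSMul k R2 M1 M2 r2) x + r1 • (rightSMul k R2 M1 M2 r2) y :=
              smul_add _ _ _
          _ = (rightSMul k R2 M1 M2 r2) (r1 • x) + (rightSMul k R2 M1 M2 r2) (r1 • y) := by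
              rw [hx, hy]
          _ = (rightSMul k R2 M1 M2 r2) (r1 • x + r1 • y) :=
              ((rightSMul k R2 M1 M2 r2).map_add _ _).symm
          _ = (rightSMul k R2 M1 M2 r2) (r1 • (x + y)) := by rw [smul_add]
  TensorProduct.Algebra.module

/-- The defining property of the `R1 ⊗[k] R2`-module structure on `M1 ⊗[k] M2`. -/
lemma tensorModule_smul_tmul (r1 : R1) (r2 : R2) (m : M1) (n : M2) :
    (r1 ⊗ₜ[k] r2 : R1 ⊗[k] R2) • (m ⊗ₜ[k] n : M1 ⊗[k] M2) = (r1 • m) ⊗ₜ[k] (r2 • n) := rfl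

end TensorModule

section HomAlg

variable (R : Type) [CommRing R]

/-- The `i`-th Ext group `Ext_R^i(M, N)`. -/
noncomputable def extGroup (M N : Type) [AddCommGroup M] [Module R M]
    [AddCommGroup N] [Module R N] (i : ℕ) : Type :=
  (((Ext R (ModuleCat R) i).obj (Opposite.op (ModuleCat.of R M))).obj (ModuleCat.of R N) :
    ModuleCat R)

/-- The `i`-th Tor group `Tor_i^R(M, N)`. -/
noncomputable def torGroup (M N : Type) [AddCommGroup M] [Module R M]
    [AddCommGroup N] [Module R N] (i : ℕ) : Type :=
  (((Tor (ModuleCat R) i).obj (ModuleCat.of R M)).obj (ModuleCat.of R N) : ModuleCat R)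

/-- `C` is a semidualizing `R`-module: it is finitely generated, the homothety map
`R → Hom_R(C,C)`, `r ↦ (x ↦ r • x)`, is bijective, and `Ext_R^i(C,C) = 0` for all `i > 0`. -/
noncomputable def IsSemidualizing (C : Type) [AddCommGroup C] [Module R C] : Prop :=
  Module.Finite R C ∧
  Function.Bijective (LinearMap.lsmul R C) ∧
  ∀ i : ℕ, 0 < i → Subsingleton (extGroup R C C i)

end HomAlg

noncomputable instance extGroupAddCommGroup (R : Type) [CommRing R] (M N : Type)
    [AddCommGroup M] [Module R M] [AddCommGroup N] [Module R N] (i : ℕ) :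
    AddCommGroup (extGroup R M N i) :=
  inferInstanceAs (AddCommGroup
    (((Ext R (ModuleCat R) i).obj (Opposite.op (ModuleCat.of R M))).obj (ModuleCat.of R N) :
      ModuleCat R))

noncomputable instance extGroupModule (R : Type) [CommRing R] (M N : Type)
    [AddCommGroup M] [Module R M] [AddCommGroup N] [Module R N] (i : ℕ) :
    Module R (extGroup R M N i) :=
  inferInstanceAs (Module R
    (((Ext R (ModuleCat R) i).obj (Opposite.op (ModuleCat.of R M))).obj (ModuleCat.of R N) :
      ModuleCat R))

/-- The coboundaries of a cochain complex. -/
def coboundaries {k : Type} [CommRing k] {C : ℕ → Type} [∀ i, AddCommGroup (C i)]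
    [∀ i, Module k (C i)] (δ : ∀ i, C i →ₗ[k] C (i + 1)) : ∀ n, Submodule k (C n)
  | 0 => ⊥
  | n + 1 => LinearMap.range (δ n)

/-- `E` is isomorphic to the `n`-th cohomology of the sequence `δ`. -/
def HasCohomology {k : Type} [CommRing k] {C : ℕ → Type} [∀ i, AddCommGroup (C i)]
    [∀ i, Module k (C i)] (δ : ∀ i, C i →ₗ[k] C (i + 1)) (n : ℕ)
    (E : Type) [AddCommMonoid E] [Module k E] : Prop :=
  ∃ φ : LinearMap.ker (δ n) →ₗ[k] E,
    Function.Surjective φ ∧ ∀ x, φ x = 0 ↔ (x : C n) ∈ coboundaries δ n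

section Cohomology

variable {k : Type} [CommRing k] {C C' : ℕ → Type} [∀ i, AddCommGroup (C i)]
  [∀ i, Module k (C i)] [∀ i, AddCommGroup (C' i)] [∀ i, Module k (C' i)]
  {E E' : Type} [AddCommMonoid E] [Module k E] [AddCommMonoid E'] [Module k E']

lemma HasCohomology.nonempty_equiv {δ : ∀ i, C i →ₗ[k] C (i + 1)} {n : ℕ}
    (h : HasCohomology δ n E) (h' : HasCohomology δ n E') : Nonempty (E ≃ₗ[k] E') := by
  let : AddCommGroup E := Module.addCommMonoidToAddCommGroup k
  let : AddCommGroup E' := Module.addCommMonoidToAddCommGroup k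
  obtain ⟨φ, hφ, hk⟩ := h
  obtain ⟨φ', hφ', hk'⟩ := h'
  have hker : LinearMap.ker φ = LinearMap.ker φ' := by
    ext x
    rw [LinearMap.mem_ker, LinearMap.mem_ker, hk, hk']
  exact ⟨(φ.quotKerEquivOfSurjective hφ).symm ≪≫ₗ Submodule.quotEquivOfEq _ _ hker ≪≫ₗ
    φ'.quotKerEquivOfSurjective hφ'⟩

lemma HasCohomology.of_equiv {δ : ∀ i, C i →ₗ[k] C (i + 1)} {δ' : ∀ i, C' i →ₗ[k] C' (i + 1)}
    (e : ∀ i, C i ≃ₗ[k] C' i) (he : ∀ i x, e (i + 1) (δ i x) = δ' i (e i x)) {n : ℕ}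
    (h : HasCohomology δ n E) : HasCohomology δ' n E := by
  obtain ⟨φ, hφ, hk⟩ := h
  have hmem : ∀ x : C' n, x ∈ LinearMap.ker (δ' n) ↔ (e n).symm x ∈ LinearMap.ker (δ n) := by
    intro x
    rw [LinearMap.mem_ker, LinearMap.mem_ker, ← (e (n + 1)).map_eq_zero_iff, he,
      LinearEquiv.apply_symm_apply]
  obtain ⟨ψ, hψ⟩ : ∃ ψ : LinearMap.ker (δ' n) →ₗ[k] LinearMap.ker (δ n),
      ∀ x, (ψ x : C n) = (e n).symm x :=
    ⟨LinearMap.codRestrict _ ((e n).symm.toLinearMap ∘ₗ (LinearMap.ker (δ' n)).subtype)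
      (fun x => (hmem x).1 x.2), fun _ => rfl⟩
  refine ⟨φ ∘ₗ ψ, fun y => ?_, fun x => ?_⟩
  · obtain ⟨x, rfl⟩ := hφ y
    refine ⟨⟨e n x, (hmem _).2 (by simp)⟩, congrArg φ (Subtype.ext ?_)⟩
    rw [hψ, LinearEquiv.symm_apply_apply]
  · rw [LinearMap.comp_apply, hk, hψ]
    cases n with
    | zero => simp [coboundaries]
    | succ n =>
      simp only [coboundaries, LinearMap.mem_range]
      constructor
      · rintro ⟨y, hy⟩
        exact ⟨e n y, by rw [← he, hy, LinearEquiv.apply_symm_apply]⟩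
      · rintro ⟨y, hy⟩
        refine ⟨(e n).symm y, (e (n + 1)).injective ?_⟩
        rw [he, LinearEquiv.apply_symm_apply, LinearEquiv.apply_symm_apply, hy]

lemma HasCohomology.restrictScalars {R : Type} [CommRing R] [Algebra k R]
    [∀ i, Module R (C i)] [∀ i, IsScalarTower k R (C i)] {F : Type} [AddCommMonoid F] [Module R F]
    {δ : ∀ i, C i →ₗ[R] C (i + 1)} {δ' : ∀ i, C i →ₗ[k] C (i + 1)}
    (hδ : ∀ i x, δ' i x = δ i x) {n : ℕ} (h : HasCohomology δ n F) :
    HasCohomology δ' n (RestrictScalars k R F) := by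
  obtain ⟨φ, hφ, hk⟩ := h
  have hmem : ∀ x, x ∈ LinearMap.ker (δ' n) ↔ x ∈ LinearMap.ker (δ n) := fun x => by
    rw [LinearMap.mem_ker, LinearMap.mem_ker, hδ]
  let e := (RestrictScalars.addEquiv k R F).symm
  refine ⟨{ toFun := fun x => e (φ ⟨x, (hmem x).1 x.2⟩)
            map_add' := fun x y => ?_
            map_smul' := fun r x => ?_ }, fun y => ?_, fun x => ?_⟩
  · rw [← map_add, ← map_add]
    rfl
  · rw [RingHom.id_apply, ← RestrictScalars.addEquiv_symm_map_algebraMap_smul, ← map_smul]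
    congr 2
    ext
    exact (algebraMap_smul R r (x : C n)).symm
  · obtain ⟨x, hx⟩ := hφ (e.symm y)
    refine ⟨⟨x, (hmem x).2 x.2⟩, ?_⟩
    exact (congrArg e hx).trans (e.apply_symm_apply y)
  · refine (e.map_eq_zero_iff).trans ((hk _).trans ?_)
    cases n with
    | zero => simp [coboundaries]
    | succ n => simp [coboundaries, hδ]

end Cohomology

section Ext

variable {R : Type} [CommRing R] {P : ℕ → Type} [∀ i, AddCommGroup (P i)] [∀ i, Module R (P i)]
  {N : Type} [AddCommGroup N] [Module R N]

/-- The chain complex in `ModuleCat R` attached to an exact sequence of modules. -/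
noncomputable def chainComplexOfExact (d : ∀ i, P (i + 1) →ₗ[R] P i)
    (hd : ∀ i, Function.Exact (d (i + 1)) (d i)) : ChainComplex (ModuleCat R) ℕ :=
  ChainComplex.of (fun i => ModuleCat.of R (P i)) (fun i => ModuleCat.ofHom (d i)) (fun i => by
    ext x
    exact (hd i).apply_apply_eq_zero x)

lemma chainComplexOfExact_d (d : ∀ i, P (i + 1) →ₗ[R] P i)
    (hd : ∀ i, Function.Exact (d (i + 1)) (d i)) (i : ℕ) :
    (chainComplexOfExact d hd).d (i + 1) i = ModuleCat.ofHom (d i) :=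
  ChainComplex.of_d (fun i => ModuleCat.of R (P i)) (fun i => ModuleCat.ofHom (d i)) i

/-- A projective resolution of modules, as a projective resolution in `ModuleCat R`. -/
noncomputable def projectiveResolutionOfExact [∀ i, Module.Projective R (P i)]
    (d : ∀ i, P (i + 1) →ₗ[R] P i)
    (hd : ∀ i, Function.Exact (d (i + 1)) (d i)) (ε : P 0 →ₗ[R] N)
    (hε : Function.Surjective ε) (h0 : Function.Exact (d 0) ε) :
    ProjectiveResolution (ModuleCat.of R N) where
  complex := chainComplexOfExact d hd
  projective n := by
    show Projective (ModuleCat.of R (P n))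
    infer_instance
  π := (ChainComplex.toSingle₀Equiv _ _).symm ⟨ModuleCat.ofHom ε, by
    rw [chainComplexOfExact_d]
    ext x
    exact h0.apply_apply_eq_zero x⟩
  quasiIso := ⟨fun n => by
    cases n
    · rw [ChainComplex.quasiIsoAt₀_iff, ShortComplex.quasiIso_iff_of_zeros']
      · let S : ShortComplex (ModuleCat R) := ShortComplex.mk (ModuleCat.ofHom (d 0))
          (ModuleCat.ofHom ε) (by ext x; exact h0.apply_apply_eq_zero x)
        have hS : S.Exact ∧ Epi S.g :=
          ⟨ModuleCat.shortComplex_exact _ h0, (ModuleCat.epi_iff_surjective _).2 hε⟩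
        refine (ShortComplex.exact_and_epi_g_iff_of_iso ?_).2 hS
        refine ShortComplex.isoMk (Iso.refl _) (Iso.refl _) (Iso.refl _) ?_ ?_
        · exact (Category.id_comp _).trans
            ((chainComplexOfExact_d d hd 0).symm.trans (Category.comp_id _).symm)
        · rfl
      all_goals rfl
    · rename_i n
      rw [quasiIsoAt_iff_exactAt']
      · rw [HomologicalComplex.exactAt_iff' _ (n + 1 + 1) (n + 1) n (by simp) (by simp)]
        refine ModuleCat.shortComplex_exact _ ?_
        show Function.Exact ((chainComplexOfExact d hd).d (n + 1 + 1) (n + 1)).hom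
          ((chainComplexOfExact d hd).d (n + 1) n).hom
        rw [chainComplexOfExact_d, chainComplexOfExact_d]
        exact hd n
      · apply ChainComplex.exactAt_succ_single_obj⟩

/-- The homology of a complex of modules, in elementary terms. -/
lemma exists_ker_to_homology {ι : Type} {c : ComplexShape ι}
    (K : HomologicalComplex (ModuleCat R) c) (i j l : ι) (hi : c.prev j = i) (hl : c.next j = l) :
    ∃ φ : LinearMap.ker (K.d j l).hom →ₗ[R] K.homology j, Function.Surjective φ ∧
      ∀ x, φ x = 0 ↔ (x : K.X j) ∈ LinearMap.range (K.d i j).hom := by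
  let S := K.sc' i j l
  let ψ : LinearMap.ker S.g.hom →ₗ[R] S.homology :=
    (S.moduleCatCyclesIso.inv ≫ S.homologyπ).hom
  have hcomm : ∀ x, S.moduleCatHomologyIso.hom.hom (ψ x) =
      (LinearMap.range S.moduleCatToCycles).mkQ x := by
    intro x
    have h : S.moduleCatCyclesIso.inv ≫ S.homologyπ ≫ S.moduleCatHomologyIso.hom =
        S.moduleCatLeftHomologyData.π := by simp
    exact congrArg (fun f => f.hom x) h
  have hbij : Function.Bijective S.moduleCatHomologyIso.hom.hom :=
    ConcreteCategory.bijective_of_isIso S.moduleCatHomologyIso.hom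
  have hψ : Function.Surjective ψ ∧ ∀ x, ψ x = 0 ↔ (x : S.X₂) ∈ LinearMap.range S.f.hom := by
    refine ⟨fun y => ?_, fun x => ?_⟩
    · obtain ⟨x, hx⟩ := Submodule.mkQ_surjective _ (S.moduleCatHomologyIso.hom.hom y)
      exact ⟨x, hbij.1 ((hcomm x).trans hx)⟩
    · have h0 : ψ x = 0 ↔ (LinearMap.range S.moduleCatToCycles).mkQ x = 0 := by
        rw [← hcomm]
        exact ⟨fun h => (congrArg _ h).trans (map_zero _), fun h => hbij.1 (h.trans (map_zero _).symm)⟩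
      rw [h0, Submodule.mkQ_apply, Submodule.Quotient.mk_eq_zero]
      constructor
      · rintro ⟨y, rfl⟩
        exact ⟨y, rfl⟩
      · rintro ⟨y, hy⟩
        exact ⟨y, Subtype.ext hy⟩
  let e : S.homology ≃ₗ[R] K.homology j := (K.homologyIsoSc' i j l hi hl).symm.toLinearEquiv
  exact ⟨e.toLinearMap ∘ₗ ψ, e.surjective.comp hψ.1,
    fun x => (e.map_eq_zero_iff).trans (hψ.2 x)⟩

lemma hasCohomology_homology (K : CochainComplex (ModuleCat R) ℕ) (n : ℕ) :
    HasCohomology (C := fun i => K.X i) (fun i => (K.d i (i + 1)).hom) n (K.homology n) := by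
  cases n with
  | zero =>
    obtain ⟨φ, hφ, h⟩ := exists_ker_to_homology K 0 0 1 (by simp) (by simp)
    refine ⟨φ, hφ, fun x => (h x).trans ?_⟩
    have h0 : K.d 0 0 = 0 := K.shape _ _ (by simp)
    rw [h0]
    simp [coboundaries]
  | succ n => exact exists_ker_to_homology K n (n + 1) (n + 2) (by simp) (by simp)

lemma hasCohomology_extGroup [∀ i, Module.Projective R (P i)]
    (d : ∀ i, P (i + 1) →ₗ[R] P i)
    (hd : ∀ i, Function.Exact (d (i + 1)) (d i)) (ε : P 0 →ₗ[R] N)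
    (hε : Function.Surjective ε) (h0 : Function.Exact (d 0) ε)
    (M : Type) [AddCommGroup M] [Module R M] (k : Type) [CommRing k] [Algebra k R] [Module k M]
    [IsScalarTower k R M] (n : ℕ) :
    HasCohomology (C := fun i => P i →ₗ[R] M) (fun i => LinearMap.lcomp k M (d i)) n
      (RestrictScalars k R (extGroup R N M n)) := by
  refine HasCohomology.restrictScalars (k := k) (C := fun i => P i →ₗ[R] M)
    (F := extGroup R N M n) (δ' := fun i => LinearMap.lcomp k M (d i))
    (δ := fun i => LinearMap.lcomp R M (d i)) (fun _ _ => rfl) ?_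
  let Q := projectiveResolutionOfExact d hd ε hε h0
  let K := Q.complex.linearYonedaObj R (ModuleCat.of R M)
  have hK := hasCohomology_homology K n
  let e : ∀ i, K.X i ≃ₗ[R] (P i →ₗ[R] M) := fun i =>
    ModuleCat.homLinearEquiv (S := R) (M := ModuleCat.of R (P i)) (N := ModuleCat.of R M)
  have hQ : HasCohomology (C := fun i => P i →ₗ[R] M)
      (fun i => LinearMap.lcomp R M (d i)) n (K.homology n) := by
    refine hK.of_equiv e fun i f => ?_
    have hd' : Q.complex.d (i + 1) i = ModuleCat.ofHom (d i) := chainComplexOfExact_d d hd i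
    have hf : (K.d i (i + 1)).hom f = Q.complex.d (i + 1) i ≫ f := rfl
    rw [hf, hd']
    rfl
  obtain ⟨φ, hφ, h⟩ := hQ
  let e' : K.homology n ≃ₗ[R] extGroup R N M n :=
    (Q.isoExt (R := R) n (ModuleCat.of R M)).symm.toLinearEquiv
  exact ⟨e'.toLinearMap ∘ₗ φ, e'.surjective.comp hφ, fun x => e'.map_eq_zero_iff.trans (h x)⟩

end Ext

section Total

variable {R : Type} [CommRing R] {X : ℕ → ℕ → Type} [∀ i j, AddCommGroup (X i j)]
  [∀ i j, Module R (X i j)]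

/-- The product of the terms of total degree `n` in a bigraded module. -/
abbrev Tot (X : ℕ → ℕ → Type) (n : ℕ) : Type :=
  ∀ pq : {pq : ℕ × ℕ // pq.1 + pq.2 = n}, X pq.1.1 pq.1.2

/-- The total map of degree `-1` induced by maps of bidegree `(-1, 0)` and `(0, -1)`. -/
def totDown (a₁ : ∀ i j, X (i + 1) j →ₗ[R] X i j) (a₂ : ∀ i j, X i (j + 1) →ₗ[R] X i j) (n : ℕ) :
    Tot X (n + 1) →ₗ[R] Tot X n :=
  LinearMap.pi fun pq =>
    a₁ pq.1.1 pq.1.2 ∘ₗ LinearMap.proj (φ := fun pq : {pq : ℕ × ℕ // pq.1 + pq.2 = n + 1} =>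
      X pq.1.1 pq.1.2) ⟨(pq.1.1 + 1, pq.1.2), by have := pq.2; omega⟩ +
    a₂ pq.1.1 pq.1.2 ∘ₗ LinearMap.proj (φ := fun pq : {pq : ℕ × ℕ // pq.1 + pq.2 = n + 1} =>
      X pq.1.1 pq.1.2) ⟨(pq.1.1, pq.1.2 + 1), by have := pq.2; omega⟩

lemma totDown_apply (a₁ : ∀ i j, X (i + 1) j →ₗ[R] X i j) (a₂ : ∀ i j, X i (j + 1) →ₗ[R] X i j)
    {n : ℕ} (x : Tot X (n + 1)) (p q : ℕ) (h : p + q = n) :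
    totDown a₁ a₂ n x ⟨(p, q), h⟩ =
      a₁ p q (x ⟨(p + 1, q), by omega⟩) + a₂ p q (x ⟨(p, q + 1), by omega⟩) :=
  rfl

/-- The first component of `totUp`. -/
def totUpFst (b₁ : ∀ i j, X i j →ₗ[R] X (i + 1) j) (n : ℕ) :
    ∀ p q, p + q = n + 1 → (Tot X n →ₗ[R] X p q)
  | 0, _, _ => 0
  | p + 1, q, h => b₁ p q ∘ₗ LinearMap.proj (φ := fun pq : {pq : ℕ × ℕ // pq.1 + pq.2 = n} =>
      X pq.1.1 pq.1.2) ⟨(p, q), by omega⟩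

/-- The second component of `totUp`. -/
def totUpSnd (b₂ : ∀ i j, X i j →ₗ[R] X i (j + 1)) (n : ℕ) :
    ∀ p q, p + q = n + 1 → (Tot X n →ₗ[R] X p q)
  | _, 0, _ => 0
  | p, q + 1, h => b₂ p q ∘ₗ LinearMap.proj (φ := fun pq : {pq : ℕ × ℕ // pq.1 + pq.2 = n} =>
      X pq.1.1 pq.1.2) ⟨(p, q), by omega⟩

/-- The total map of degree `1` induced by maps of bidegree `(1, 0)` and `(0, 1)`. -/
def totUp (b₁ : ∀ i j, X i j →ₗ[R] X (i + 1) j) (b₂ : ∀ i j, X i j →ₗ[R] X i (j + 1)) (n : ℕ) :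
    Tot X n →ₗ[R] Tot X (n + 1) :=
  LinearMap.pi fun pq => totUpFst b₁ n pq.1.1 pq.1.2 pq.2 + totUpSnd b₂ n pq.1.1 pq.1.2 pq.2

section

variable (b₁ : ∀ i j, X i j →ₗ[R] X (i + 1) j) (b₂ : ∀ i j, X i j →ₗ[R] X i (j + 1)) {n : ℕ}
  (x : Tot X n)

lemma totUp_apply_zero_succ (q : ℕ) (h : 0 + (q + 1) = n + 1) :
    totUp b₁ b₂ n x ⟨(0, q + 1), h⟩ = b₂ 0 q (x ⟨(0, q), by omega⟩) :=
  zero_add _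

lemma totUp_apply_succ_zero (p : ℕ) (h : p + 1 + 0 = n + 1) :
    totUp b₁ b₂ n x ⟨(p + 1, 0), h⟩ = b₁ p 0 (x ⟨(p, 0), by omega⟩) :=
  add_zero _

lemma totUp_apply_succ_succ (p q : ℕ) (h : p + 1 + (q + 1) = n + 1) :
    totUp b₁ b₂ n x ⟨(p + 1, q + 1), h⟩ =
      b₁ p (q + 1) (x ⟨(p, q + 1), by omega⟩) + b₂ (p + 1) q (x ⟨(p + 1, q), by omega⟩) :=
  rfl

end

lemma totDown_totDown (a₁ : ∀ i j, X (i + 1) j →ₗ[R] X i j) (a₂ : ∀ i j, X i (j + 1) →ₗ[R] X i j)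
    (h₁ : ∀ i j x, a₁ i j (a₁ (i + 1) j x) = 0) (h₂ : ∀ i j x, a₂ i j (a₂ i (j + 1) x) = 0)
    (h : ∀ i j x, a₁ i j (a₂ (i + 1) j x) + a₂ i j (a₁ i (j + 1) x) = 0) (n : ℕ)
    (x : Tot X (n + 2)) : totDown a₁ a₂ n (totDown a₁ a₂ (n + 1) x) = 0 := by
  funext ⟨⟨p, q⟩, hpq⟩
  simp only [totDown_apply, map_add, h₁, h₂, zero_add, add_zero, h, Pi.zero_apply]

section

variable {a₁ : ∀ i j, X (i + 1) j →ₗ[R] X i j} {a₂ : ∀ i j, X i (j + 1) →ₗ[R] X i j}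
  {b₁ : ∀ i j, X i j →ₗ[R] X (i + 1) j} {b₂ : ∀ i j, X i j →ₗ[R] X i (j + 1)}
  {f₁ f₂ : ∀ i j, X i j →ₗ[R] X i j}

lemma totDown_totUp_zero (h₁ : ∀ j x, f₁ 0 j x = a₁ 0 j (b₁ 0 j x))
    (h₂ : ∀ i x, f₂ i 0 x = a₂ i 0 (b₂ i 0 x)) (x : Tot X 0) :
    totDown a₁ a₂ 0 (totUp b₁ b₂ 0 x) = fun pq => f₁ _ _ (x pq) + f₂ _ _ (x pq) := by
  funext ⟨⟨p, q⟩, hpq⟩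
  obtain rfl : p = 0 := by simp only at hpq; omega
  obtain rfl : q = 0 := by simp only at hpq; omega
  rw [totDown_apply, totUp_apply_succ_zero, totUp_apply_zero_succ, h₁, h₂]

lemma totDown_totUp_succ (h₁ : ∀ j x, f₁ 0 j x = a₁ 0 j (b₁ 0 j x))
    (h₁' : ∀ i j x, f₁ (i + 1) j x = a₁ (i + 1) j (b₁ (i + 1) j x) + b₁ i j (a₁ i j x))
    (h₂ : ∀ i x, f₂ i 0 x = a₂ i 0 (b₂ i 0 x))
    (h₂' : ∀ i j x, f₂ i (j + 1) x = a₂ i (j + 1) (b₂ i (j + 1) x) + b₂ i j (a₂ i j x))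
    (h₁₂ : ∀ i j x, a₁ i (j + 1) (b₂ (i + 1) j x) + b₂ i j (a₁ i j x) = 0)
    (h₂₁ : ∀ i j x, a₂ (i + 1) j (b₁ i (j + 1) x) + b₁ i j (a₂ i j x) = 0)
    {n : ℕ} (x : Tot X (n + 1)) :
    totDown a₁ a₂ (n + 1) (totUp b₁ b₂ (n + 1) x) + totUp b₁ b₂ n (totDown a₁ a₂ n x) =
      fun pq => f₁ _ _ (x pq) + f₂ _ _ (x pq) := by
  funext ⟨⟨p, q⟩, hpq⟩
  rw [Pi.add_apply, totDown_apply]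
  rcases p with _ | p <;> rcases q with _ | q
  · simp at hpq
  · have e := h₁₂ 0 q (x ⟨(1, q), by simp only at hpq; omega⟩)
    rw [totUp_apply_succ_succ, totUp_apply_zero_succ, totUp_apply_zero_succ, totDown_apply,
      h₁, h₂', map_add, map_add, ← sub_eq_zero, ← e]
    abel
  · have e := h₂₁ p 0 (x ⟨(p, 1), by simp only at hpq; omega⟩)
    rw [totUp_apply_succ_succ, totUp_apply_succ_zero, totUp_apply_succ_zero, totDown_apply,
      h₁', h₂, map_add, map_add, ← sub_eq_zero, ← e]
    abel
  · have e := h₁₂ (p + 1) q (x ⟨(p + 1 + 1, q), by simp only at hpq; omega⟩)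
    have e' := h₂₁ p (q + 1) (x ⟨(p, q + 1 + 1), by simp only at hpq; omega⟩)
    have ee := (congrArg₂ (· + ·) e e').trans (add_zero 0)
    beta_reduce at ee
    rw [totUp_apply_succ_succ, totUp_apply_succ_succ, totUp_apply_succ_succ, totDown_apply,
      totDown_apply, h₁', h₂', map_add, map_add, map_add, map_add, ← sub_eq_zero, ← ee]
    abel

end

end Total

section TensorTotal

variable {k : Type} [CommRing k] {A B : ℕ → Type} [∀ i, AddCommGroup (A i)] [∀ i, Module k (A i)]
  [∀ i, AddCommGroup (B i)] [∀ i, Module k (B i)]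

/-- The tensor product of linear maps, with the sign `(-1) ^ i`. -/
noncomputable def signedMap {P P' Q Q' : Type} [AddCommGroup P] [Module k P] [AddCommGroup P']
    [Module k P'] [AddCommGroup Q] [Module k Q] [AddCommGroup Q'] [Module k Q'] (i : ℕ)
    (f : P →ₗ[k] P') (g : Q →ₗ[k] Q') : P ⊗[k] Q →ₗ[k] P' ⊗[k] Q' :=
  (-1 : ℤ) ^ i • TensorProduct.map f g

lemma signedMap_tmul {P P' Q Q' : Type} [AddCommGroup P] [Module k P] [AddCommGroup P']
    [Module k P'] [AddCommGroup Q] [Module k Q] [AddCommGroup Q'] [Module k Q'] (i : ℕ)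
    (f : P →ₗ[k] P') (g : Q →ₗ[k] Q') (x : P) (y : Q) :
    signedMap i f g (x ⊗ₜ y) = (-1 : ℤ) ^ i • (f x ⊗ₜ[k] g y) := rfl

lemma linearMap_ext_tmul {P Q T : Type} [AddCommGroup P] [Module k P] [AddCommGroup Q] [Module k Q]
    [AddCommGroup T] [Module k T] (f g : P ⊗[k] Q →ₗ[k] T) (h : ∀ x y, f (x ⊗ₜ y) = g (x ⊗ₜ y)) :
    ∀ z, f z = g z :=
  fun z => congrArg (fun l : P ⊗[k] Q →ₗ[k] T => l z) (TensorProduct.ext' h)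

variable {u : ∀ i, A i →ₗ[k] A (i + 1)} {v : ∀ i, A (i + 1) →ₗ[k] A i} {π s t : ∀ i, A i →ₗ[k] A i}
  {u' : ∀ i, B i →ₗ[k] B (i + 1)} {v' : ∀ i, B (i + 1) →ₗ[k] B i} {π' : ∀ i, B i →ₗ[k] B i}

lemma tensor_homotopy_zero
    (h₀ : ∀ x, x - π 0 x = v 0 (u 0 x)) (h₀' : ∀ x, x - π' 0 x = v' 0 (u' 0 x))
    (hst : ∀ i x, t i (s i x) = π i x)
    (x : Tot (fun i j => A i ⊗[k] B j) 0) :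
    totDown (fun i j => TensorProduct.map (v i) (LinearMap.id : B j →ₗ[k] B j))
        (fun i j => signedMap i (t i) (v' j)) 0
      (totUp (fun i j => TensorProduct.map (u i) (LinearMap.id : B j →ₗ[k] B j))
        (fun i j => signedMap i (s i) (u' j)) 0 x) =
      fun pq => x pq - TensorProduct.map (π pq.1.1) (π' pq.1.2) (x pq) := by
  rw [totDown_totUp_zero
    (f₁ := fun i j => TensorProduct.map (LinearMap.id - π i) (LinearMap.id : B j →ₗ[k] B j))
    (f₂ := fun i j => TensorProduct.map (π i) (LinearMap.id - π' j))]
  · funext pq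
    refine linearMap_ext_tmul
      (TensorProduct.map (LinearMap.id - π pq.1.1) (LinearMap.id : B pq.1.2 →ₗ[k] B pq.1.2) +
        TensorProduct.map (π pq.1.1) (LinearMap.id - π' pq.1.2))
      (LinearMap.id - TensorProduct.map (π pq.1.1) (π' pq.1.2)) (fun a b => ?_) _
    simp [TensorProduct.sub_tmul, TensorProduct.tmul_sub]
  · refine fun j => linearMap_ext_tmul _
      (TensorProduct.map (v 0) (LinearMap.id : B j →ₗ[k] B j) ∘ₗ
        TensorProduct.map (u 0) (LinearMap.id : B j →ₗ[k] B j))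
      fun a b => ?_
    simp [h₀]
  · refine fun i => linearMap_ext_tmul _ (signedMap _ _ _ ∘ₗ signedMap _ _ _) fun a b => ?_
    simp [signedMap_tmul, h₀', hst, smul_smul, ← mul_pow]

lemma tensor_homotopy_succ
    (h₀ : ∀ x, x - π 0 x = v 0 (u 0 x)) (h₀' : ∀ x, x - π' 0 x = v' 0 (u' 0 x))
    (h : ∀ i x, x - π (i + 1) x = v (i + 1) (u (i + 1) x) + u i (v i x))
    (h' : ∀ i x, x - π' (i + 1) x = v' (i + 1) (u' (i + 1) x) + u' i (v' i x))
    (hst : ∀ i x, t i (s i x) = π i x) (hts : ∀ i x, s i (t i x) = π i x)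
    (hs : ∀ i x, v i (s (i + 1) x) = s i (v i x)) (ht : ∀ i x, t (i + 1) (u i x) = u i (t i x))
    {n : ℕ} (x : Tot (fun i j => A i ⊗[k] B j) (n + 1)) :
    totDown (fun i j => TensorProduct.map (v i) (LinearMap.id : B j →ₗ[k] B j))
        (fun i j => signedMap i (t i) (v' j)) (n + 1)
      (totUp (fun i j => TensorProduct.map (u i) (LinearMap.id : B j →ₗ[k] B j))
        (fun i j => signedMap i (s i) (u' j)) (n + 1) x) +
    totUp (fun i j => TensorProduct.map (u i) (LinearMap.id : B j →ₗ[k] B j))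
        (fun i j => signedMap i (s i) (u' j)) n
      (totDown (fun i j => TensorProduct.map (v i) (LinearMap.id : B j →ₗ[k] B j))
        (fun i j => signedMap i (t i) (v' j)) n x) =
      fun pq => x pq - TensorProduct.map (π pq.1.1) (π' pq.1.2) (x pq) := by
  rw [totDown_totUp_succ
    (f₁ := fun i j => TensorProduct.map (LinearMap.id - π i) (LinearMap.id : B j →ₗ[k] B j))
    (f₂ := fun i j => TensorProduct.map (π i) (LinearMap.id - π' j))]
  · funext pq
    refine linearMap_ext_tmul
      (TensorProduct.map (LinearMap.id - π pq.1.1) (LinearMap.id : B pq.1.2 →ₗ[k] B pq.1.2) +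
        TensorProduct.map (π pq.1.1) (LinearMap.id - π' pq.1.2))
      (LinearMap.id - TensorProduct.map (π pq.1.1) (π' pq.1.2)) (fun a b => ?_) _
    simp [TensorProduct.sub_tmul, TensorProduct.tmul_sub]
  · refine fun j => linearMap_ext_tmul _
      (TensorProduct.map (v 0) (LinearMap.id : B j →ₗ[k] B j) ∘ₗ
        TensorProduct.map (u 0) (LinearMap.id : B j →ₗ[k] B j))
      fun a b => ?_
    simp [h₀]
  · refine fun i j => linearMap_ext_tmul _
      (TensorProduct.map (v (i + 1)) (LinearMap.id : B j →ₗ[k] B j) ∘ₗ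
        TensorProduct.map (u (i + 1)) (LinearMap.id : B j →ₗ[k] B j) +
      TensorProduct.map (u i) (LinearMap.id : B j →ₗ[k] B j) ∘ₗ
        TensorProduct.map (v i) (LinearMap.id : B j →ₗ[k] B j)) fun a b => ?_
    simp [h, TensorProduct.add_tmul]
  · refine fun i => linearMap_ext_tmul _ (signedMap _ _ _ ∘ₗ signedMap _ _ _) fun a b => ?_
    simp [signedMap_tmul, h₀', hst, smul_smul, ← mul_pow]
  · refine fun i j => linearMap_ext_tmul _ (signedMap _ _ _ ∘ₗ signedMap _ _ _ +
      signedMap _ _ _ ∘ₗ signedMap _ _ _) fun a b => ?_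
    simp [signedMap_tmul, h', hst, hts, smul_smul, ← mul_pow, TensorProduct.tmul_add]
  · refine fun i j => linearMap_ext_tmul (TensorProduct.map _ _ ∘ₗ signedMap _ _ _ +
      signedMap _ _ _ ∘ₗ TensorProduct.map _ _) 0 fun a b => ?_
    simp [signedMap_tmul, hs, pow_succ]
  · refine fun i j => linearMap_ext_tmul (signedMap _ _ _ ∘ₗ TensorProduct.map _ _ +
      TensorProduct.map _ _ ∘ₗ signedMap _ _ _) 0 fun a b => ?_
    simp [signedMap_tmul, ht, pow_succ]

end TensorTotal

section Kunneth

variable {k : Type} [Field k]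

lemma exists_comp_comp_eq {V W : Type} [AddCommGroup V] [Module k V] [AddCommGroup W] [Module k W]
    (f : V →ₗ[k] W) : ∃ g : W →ₗ[k] V, ∀ x, f (g (f x)) = f x := by
  obtain ⟨s, hs⟩ := f.rangeRestrict.exists_rightInverse_of_surjective f.range_rangeRestrict
  obtain ⟨g, hg⟩ := s.exists_extend
  refine ⟨g, fun x => ?_⟩
  have h₁ : g (f x) = s (f.rangeRestrict x) := LinearMap.congr_fun hg (f.rangeRestrict x)
  have h₂ := LinearMap.congr_fun hs (f.rangeRestrict x)
  rw [h₁]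
  exact congrArg Subtype.val h₂

variable {A B E F : ℕ → Type} [∀ i, AddCommGroup (A i)] [∀ i, Module k (A i)]
  [∀ i, AddCommGroup (B i)] [∀ i, Module k (B i)] [∀ i, AddCommGroup (E i)] [∀ i, Module k (E i)]
  [∀ i, AddCommGroup (F i)] [∀ i, Module k (F i)]

lemma HasCohomology.of_retract {δ : ∀ n, A n →ₗ[k] A (n + 1)} {n : ℕ} {G : Type} [AddCommGroup G]
    [Module k G] (ι : G →ₗ[k] A n) (ρ : A n →ₗ[k] G) (hι : ∀ x, δ n (ι x) = 0)
    (hρ : ∀ x ∈ coboundaries δ n, ρ x = 0) (hρι : ∀ x, ρ (ι x) = x)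
    (h : ∀ x, δ n x = 0 → ρ x = 0 → x ∈ coboundaries δ n) : HasCohomology δ n G :=
  ⟨ρ ∘ₗ (LinearMap.ker (δ n)).subtype, fun x => ⟨⟨ι x, hι x⟩, hρι x⟩,
    fun x => ⟨fun hx => h _ x.2 hx, fun hx => hρ _ hx⟩⟩

lemma exists_splitting (δ : ∀ n, A n →ₗ[k] A (n + 1)) (hδ : ∀ n x, δ (n + 1) (δ n x) = 0)
    (hE : ∀ n, HasCohomology δ n (E n)) :
    ∃ (ι : ∀ n, E n →ₗ[k] A n) (ρ : ∀ n, A n →ₗ[k] E n) (h : ∀ n, A (n + 1) →ₗ[k] A n),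
      (∀ n x, δ n (ι n x) = 0) ∧ (∀ n x, ρ (n + 1) (δ n x) = 0) ∧ (∀ n x, ρ n (ι n x) = x) ∧
      (∀ x, x - ι 0 (ρ 0 x) = h 0 (δ 0 x)) ∧
      ∀ n x, x - ι (n + 1) (ρ (n + 1) x) = h (n + 1) (δ (n + 1) x) + δ n (h n x) := by
  choose g hg using fun n => exists_comp_comp_eq (δ n)
  choose φ hφ hφ₀ using hE
  choose σ hσ using fun n => (φ n).exists_rightInverse_of_surjective (LinearMap.range_eq_top.2 (hφ n))
  let P : ∀ n, A n →ₗ[k] LinearMap.ker (δ n) := fun n =>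
    (LinearMap.id - g n ∘ₗ δ n).codRestrict _ fun x => by simp [hg]
  have hP : ∀ n x, (P n x : A n) = x - g n (δ n x) := fun n x => rfl
  let ι : ∀ n, E n →ₗ[k] A n := fun n => (LinearMap.ker (δ n)).subtype ∘ₗ σ n
  let ρ : ∀ n, A n →ₗ[k] E n := fun n => φ n ∘ₗ P n
  have hι : ∀ n x, δ n (ι n x) = 0 := fun n x => (σ n x).2
  have hρ : ∀ n x, ρ (n + 1) (δ n x) = 0 := fun n x => by
    refine (hφ₀ (n + 1) _).2 ?_
    rw [hP, hδ, map_zero, sub_zero]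
    exact ⟨x, rfl⟩
  have hρι : ∀ n x, ρ n (ι n x) = x := fun n x => by
    have : P n (ι n x) = σ n x := by
      apply Subtype.ext
      rw [hP, hι, map_zero, sub_zero]
      rfl
    exact (congrArg (φ n) this).trans (LinearMap.congr_fun (hσ n) x)
  have key : ∀ n x, x - g n (δ n x) - ι n (ρ n x) ∈ coboundaries δ n := fun n x => by
    refine (hφ₀ n (P n x - σ n (ρ n x))).1 ?_
    rw [map_sub, sub_eq_zero]
    exact (LinearMap.congr_fun (hσ n) (ρ n x)).symm
  refine ⟨ι, ρ, fun n => g n ∘ₗ (LinearMap.id - g (n + 1) ∘ₗ δ (n + 1) - ι (n + 1) ∘ₗ ρ (n + 1)),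
    hι, hρ, hρι, fun x => ?_, fun n x => ?_⟩
  · have h0 : x - g 0 (δ 0 x) - ι 0 (ρ 0 x) = 0 := key 0 x
    simp only [LinearMap.comp_apply, LinearMap.sub_apply, LinearMap.id_apply, hδ, hρ, map_zero,
      sub_zero]
    rw [← sub_eq_zero, ← h0]
    abel
  · obtain ⟨y, hy⟩ := key (n + 1) x
    simp only [LinearMap.comp_apply, LinearMap.sub_apply, LinearMap.id_apply, hδ, hρ, map_zero,
      sub_zero]
    rw [← hy, hg, hy]
    abel

lemma totUp_eq_zero {R : Type} [CommRing R] {X Y : ℕ → ℕ → Type} [∀ i j, AddCommGroup (X i j)]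
    [∀ i j, Module R (X i j)] [∀ i j, AddCommGroup (Y i j)] [∀ i j, Module R (Y i j)]
    {b₁ : ∀ i j, X i j →ₗ[R] X (i + 1) j} {b₂ : ∀ i j, X i j →ₗ[R] X i (j + 1)}
    (f : ∀ i j, X i j →ₗ[R] Y i j) {n : ℕ} (x : Tot X n)
    (h₁ : ∀ i j h, f (i + 1) j (b₁ i j (x ⟨(i, j), h⟩)) = 0)
    (h₂ : ∀ i j h, f i (j + 1) (b₂ i j (x ⟨(i, j), h⟩)) = 0) (pq) :
    f _ _ (totUp b₁ b₂ n x pq) = 0 := by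
  obtain ⟨⟨p, q⟩, hpq⟩ := pq
  rcases p with _ | p <;> rcases q with _ | q
  · simp at hpq
  · rw [totUp_apply_zero_succ, h₂]
  · rw [totUp_apply_succ_zero, h₁]
  · rw [totUp_apply_succ_succ, map_add, h₁, h₂, add_zero]

lemma HasCohomology.tensor {δ : ∀ n, A n →ₗ[k] A (n + 1)} (hδ : ∀ n x, δ (n + 1) (δ n x) = 0)
    (hE : ∀ n, HasCohomology δ n (E n)) {δ' : ∀ n, B n →ₗ[k] B (n + 1)}
    (hδ' : ∀ n x, δ' (n + 1) (δ' n x) = 0) (hF : ∀ n, HasCohomology δ' n (F n)) (n : ℕ) :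
    HasCohomology (C := Tot fun i j => A i ⊗[k] B j)
      (totUp (fun i j => TensorProduct.map (δ i) (LinearMap.id : B j →ₗ[k] B j))
        (fun i j => signedMap i (LinearMap.id : A i →ₗ[k] A i) (δ' j))) n
      (Tot (fun i j => E i ⊗[k] F j) n) := by
  obtain ⟨ι, ρ, h, hι, hρ, hρι, h₀, h₁⟩ := exists_splitting δ hδ hE
  obtain ⟨ι', ρ', h', hι', hρ', hρι', h₀', h₁'⟩ := exists_splitting δ' hδ' hF
  have hππ : ∀ i j (z : A i ⊗[k] B j), TensorProduct.map (ρ i) (ρ' j) z = 0 →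
      TensorProduct.map (ι i ∘ₗ ρ i) (ι' j ∘ₗ ρ' j) z = 0 := fun i j z hz => by
    rw [TensorProduct.map_comp, LinearMap.comp_apply, hz, map_zero]
  refine HasCohomology.of_retract
    (LinearMap.pi fun pq => TensorProduct.map (ι pq.1.1) (ι' pq.1.2) ∘ₗ
      LinearMap.proj (φ := fun pq : {pq : ℕ × ℕ // pq.1 + pq.2 = n} => E pq.1.1 ⊗[k] F pq.1.2) pq)
    (LinearMap.pi fun pq => TensorProduct.map (ρ pq.1.1) (ρ' pq.1.2) ∘ₗ
      LinearMap.proj (φ := fun pq : {pq : ℕ × ℕ // pq.1 + pq.2 = n} => A pq.1.1 ⊗[k] B pq.1.2) pq)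
    (fun x => ?_) ?_ (fun x => ?_) ?_
  · funext pq
    refine totUp_eq_zero (fun i j => (LinearMap.id : A i ⊗[k] B j →ₗ[k] _)) _ ?_ ?_ pq
    · exact fun i j e => linearMap_ext_tmul (TensorProduct.map (δ i) LinearMap.id ∘ₗ
        TensorProduct.map (ι i) (ι' j)) 0 (fun a b => by simp [hι]) _
    · exact fun i j e => linearMap_ext_tmul (signedMap i LinearMap.id (δ' j) ∘ₗ
        TensorProduct.map (ι i) (ι' j)) 0 (fun a b => by simp [signedMap_tmul, hι']) _
  · cases n with
    | zero =>
      rintro x (rfl : x = 0)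
      exact map_zero _
    | succ n =>
      rintro _ ⟨x, rfl⟩
      funext pq
      refine totUp_eq_zero (fun i j => TensorProduct.map (ρ i) (ρ' j)) x ?_ ?_ pq
      · exact fun i j e => linearMap_ext_tmul (TensorProduct.map (ρ (i + 1)) (ρ' j) ∘ₗ
          TensorProduct.map (δ i) LinearMap.id) 0 (fun a b => by simp [hρ]) _
      · exact fun i j e => linearMap_ext_tmul (TensorProduct.map (ρ i) (ρ' (j + 1)) ∘ₗ
          signedMap i LinearMap.id (δ' j)) 0 (fun a b => by simp [signedMap_tmul, hρ']) _
  · funext pq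
    exact linearMap_ext_tmul (TensorProduct.map (ρ pq.1.1) (ρ' pq.1.2) ∘ₗ
      TensorProduct.map (ι pq.1.1) (ι' pq.1.2)) LinearMap.id (fun a b => by simp [hρι, hρι']) _
  · intro x hx hρx
    have hπx : (fun pq => x pq - TensorProduct.map (ι pq.1.1 ∘ₗ ρ pq.1.1)
        (ι' pq.1.2 ∘ₗ ρ' pq.1.2) (x pq)) = x := by
      funext pq
      rw [hππ _ _ (x pq) (congrFun hρx pq), sub_zero]
    cases n with
    | zero =>
      have := tensor_homotopy_zero (u := δ) (v := h) (u' := δ') (v' := h')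
        (π := fun i => ι i ∘ₗ ρ i) (π' := fun i => ι' i ∘ₗ ρ' i) (s := fun i => LinearMap.id)
        (t := fun i => ι i ∘ₗ ρ i) h₀ h₀' (fun _ _ => rfl) x
      rw [hx, map_zero, hπx] at this
      exact this.symm
    | succ n =>
      have := tensor_homotopy_succ (u := δ) (v := h) (u' := δ') (v' := h')
        (π := fun i => ι i ∘ₗ ρ i) (π' := fun i => ι' i ∘ₗ ρ' i) (s := fun i => LinearMap.id)
        (t := fun i => ι i ∘ₗ ρ i) h₀ h₀' h₁ h₁' (fun _ _ => rfl) (fun _ _ => rfl)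
        (fun _ _ => rfl) (fun i y => by simp [hρ, hι]) x
      rw [hx, map_zero, hπx, zero_add] at this
      exact ⟨_, this⟩

end Kunneth

section TensorExact

variable {k : Type} [Field k] {P Q : ℕ → Type} [∀ i, AddCommGroup (P i)] [∀ i, Module k (P i)]
  [∀ i, AddCommGroup (Q i)] [∀ i, Module k (Q i)] {N N' : Type} [AddCommGroup N] [Module k N]
  [AddCommGroup N'] [Module k N']

lemma exists_contraction (d : ∀ i, P (i + 1) →ₗ[k] P i) (ε : P 0 →ₗ[k] N)
    (hd : ∀ i, Function.Exact (d (i + 1)) (d i)) (hε : Function.Surjective ε)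
    (h0 : Function.Exact (d 0) ε) :
    ∃ (σ : N →ₗ[k] P 0) (h : ∀ i, P i →ₗ[k] P (i + 1)), (∀ x, x - σ (ε x) = d 0 (h 0 x)) ∧
      ∀ i x, x = d (i + 1) (h (i + 1) x) + h i (d i x) := by
  obtain ⟨σ, hσ⟩ := ε.exists_rightInverse_of_surjective (LinearMap.range_eq_top.2 hε)
  replace hσ : ∀ x, ε (σ x) = x := LinearMap.congr_fun hσ
  choose g hg using fun n => exists_comp_comp_eq (d n)
  refine ⟨σ, fun
    | 0 => g 0 ∘ₗ (LinearMap.id - σ ∘ₗ ε)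
    | i + 1 => g (i + 1) ∘ₗ (LinearMap.id - g i ∘ₗ d i), fun x => ?_, fun i x => ?_⟩
  · obtain ⟨y, hy⟩ := (h0 (x - σ (ε x))).1 (by rw [map_sub, hσ, sub_self])
    simp only [LinearMap.comp_apply, LinearMap.sub_apply, LinearMap.id_apply]
    rw [← hy, hg]
  · obtain ⟨y, hy⟩ := (hd i (x - g i (d i x))).1 (by rw [map_sub, hg, sub_self])
    cases i with
    | zero =>
      simp only [LinearMap.comp_apply, LinearMap.sub_apply, LinearMap.id_apply,
        h0.apply_apply_eq_zero, map_zero, sub_zero]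
      rw [← hy, hg, hy, sub_add_cancel]
    | succ i =>
      simp only [LinearMap.comp_apply, LinearMap.sub_apply, LinearMap.id_apply,
        (hd i).apply_apply_eq_zero, map_zero, sub_zero]
      rw [← hy, hg, hy, sub_add_cancel]

/-- The projection of a resolution onto the image of a section `σ` of the augmentation. -/
def augmentationProj (σ : N →ₗ[k] P 0) (ε : P 0 →ₗ[k] N) : ∀ i, P i →ₗ[k] P i
  | 0 => σ ∘ₗ ε
  | _ + 1 => 0

variable {d : ∀ i, P (i + 1) →ₗ[k] P i} {ε : P 0 →ₗ[k] N}
  (hd : ∀ i, Function.Exact (d (i + 1)) (d i)) (hε : Function.Surjective ε)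
  (h0 : Function.Exact (d 0) ε) {d' : ∀ i, Q (i + 1) →ₗ[k] Q i} {ε' : Q 0 →ₗ[k] N'}
  (hd' : ∀ i, Function.Exact (d' (i + 1)) (d' i)) (hε' : Function.Surjective ε')
  (h0' : Function.Exact (d' 0) ε')

variable (d d' ε ε') in
/-- The differential of the tensor product of two chain complexes. -/
noncomputable def chainDiff (n : ℕ) :
    Tot (fun i j => P i ⊗[k] Q j) (n + 1) →ₗ[k] Tot (fun i j => P i ⊗[k] Q j) n :=
  totDown (fun i j => TensorProduct.map (d i) (LinearMap.id : Q j →ₗ[k] Q j))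
    (fun i j => signedMap i (LinearMap.id : P i →ₗ[k] P i) (d' j)) n

include hd hε h0 hd' hε' h0'

lemma chainDiff_exact_zero (x : Tot (fun i j => P i ⊗[k] Q j) 0) :
    TensorProduct.map ε ε' (x ⟨(0, 0), rfl⟩) = 0 ↔ x ∈ Set.range (chainDiff d d' 0) := by
  constructor
  · intro hx
    obtain ⟨σ, h, h₀, h₁⟩ := exists_contraction d ε hd hε h0
    obtain ⟨σ', h', h₀', h₁'⟩ := exists_contraction d' ε' hd' hε' h0'
    refine ⟨_, (tensor_homotopy_zero (u := h) (v := d) (u' := h') (v' := d')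
      (π := augmentationProj σ ε) (π' := augmentationProj σ' ε') (s := augmentationProj σ ε)
      (t := fun i => LinearMap.id) h₀ h₀' (fun _ _ => rfl) x).trans ?_⟩
    funext ⟨⟨p, q⟩, hpq⟩
    obtain rfl : p = 0 := by simp only at hpq; omega
    obtain rfl : q = 0 := by simp only at hpq; omega
    simp only [augmentationProj]
    rw [TensorProduct.map_comp, LinearMap.comp_apply, hx, map_zero, sub_zero]
  · rintro ⟨y, rfl⟩
    rw [chainDiff, totDown_apply, map_add]
    have e₁ := linearMap_ext_tmul (TensorProduct.map ε ε' ∘ₗ TensorProduct.map (d 0) LinearMap.id) 0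
      (fun a b => by simp [h0.apply_apply_eq_zero]) (y ⟨(1, 0), rfl⟩)
    have e₂ := linearMap_ext_tmul (TensorProduct.map ε ε' ∘ₗ signedMap 0 LinearMap.id (d' 0)) 0
      (fun a b => by simp [signedMap_tmul, h0'.apply_apply_eq_zero]) (y ⟨(0, 1), rfl⟩)
    exact (congrArg₂ (· + ·) e₁ e₂).trans (add_zero 0)

lemma chainDiff_exact_succ (n : ℕ) : Function.Exact (chainDiff d d' (n + 1)) (chainDiff d d' n) := by
  intro x
  constructor
  · intro hx
    obtain ⟨σ, h, h₀, h₁⟩ := exists_contraction d ε hd hε h0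
    obtain ⟨σ', h', h₀', h₁'⟩ := exists_contraction d' ε' hd' hε' h0'
    have := tensor_homotopy_succ (u := h) (v := d) (u' := h') (v' := d')
      (π := augmentationProj σ ε) (π' := augmentationProj σ' ε') (s := augmentationProj σ ε)
      (t := fun i => LinearMap.id) h₀ h₀' (fun i x => by simpa [augmentationProj] using h₁ i x)
      (fun i x => by simpa [augmentationProj] using h₁' i x) (fun _ _ => rfl) (fun _ _ => rfl)
      (fun i x => by cases i <;> simp [augmentationProj, h0.apply_apply_eq_zero])
      (fun _ _ => rfl) x
    rw [chainDiff] at hx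
    rw [hx, map_zero, add_zero] at this
    refine ⟨_, this.trans ?_⟩
    funext ⟨⟨p, q⟩, hpq⟩
    rcases p with _ | p <;> rcases q with _ | q
    · simp at hpq
    all_goals simp [augmentationProj]
  · rintro ⟨y, rfl⟩
    refine totDown_totDown _ _ (fun i j z => ?_) (fun i j z => ?_) (fun i j z => ?_) n y
    · exact linearMap_ext_tmul (TensorProduct.map (d i) LinearMap.id ∘ₗ
        TensorProduct.map (d (i + 1)) LinearMap.id) 0
        (fun a b => by simp [(hd i).apply_apply_eq_zero]) z
    · exact linearMap_ext_tmul (signedMap i LinearMap.id (d' j) ∘ₗ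
        signedMap i LinearMap.id (d' (j + 1))) 0
        (fun a b => by simp [signedMap_tmul, (hd' j).apply_apply_eq_zero]) z
    · exact linearMap_ext_tmul (TensorProduct.map (d i) LinearMap.id ∘ₗ
        signedMap (i + 1) LinearMap.id (d' j) +
        signedMap i LinearMap.id (d' j) ∘ₗ TensorProduct.map (d i) LinearMap.id) 0
        (fun a b => by simp [signedMap_tmul, pow_succ]) z

end TensorExact

section TensorHom

variable {k : Type} [CommRing k] {R1 R2 : Type} [CommRing R1] [CommRing R2]
  [Algebra k R1] [Algebra k R2]

section

variable {P P' Q Q' : Type} [AddCommGroup P] [Module k P] [Module R1 P] [IsScalarTower k R1 P]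
  [AddCommGroup P'] [Module k P'] [Module R1 P'] [IsScalarTower k R1 P']
  [AddCommGroup Q] [Module k Q] [Module R2 Q] [IsScalarTower k R2 Q]
  [AddCommGroup Q'] [Module k Q'] [Module R2 Q'] [IsScalarTower k R2 Q']

instance tensorModule_isScalarTower : IsScalarTower k (R1 ⊗[k] R2) (P ⊗[k] Q) where
  smul_assoc c s z := by
    induction z using TensorProduct.induction_on with
    | zero => simp only [smul_zero]
    | add x y hx hy => simp only [smul_add, hx, hy]
    | tmul x y =>
      induction s using TensorProduct.induction_on with
      | zero => simp only [smul_zero, zero_smul]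
      | add a b ha hb => simp only [smul_add, add_smul, ha, hb]
      | tmul a b =>
        rw [smul_tmul', tensorModule_smul_tmul, tensorModule_smul_tmul, smul_tmul', smul_assoc]

/-- The tensor product of an `R1`-linear map and an `R2`-linear map, as an `R1 ⊗ R2`-linear
map. -/
noncomputable def tensorMap (f : P →ₗ[R1] P') (g : Q →ₗ[R2] Q') :
    P ⊗[k] Q →ₗ[R1 ⊗[k] R2] P' ⊗[k] Q' where
  toFun := TensorProduct.map (f.restrictScalars k) (g.restrictScalars k)
  map_add' := map_add _
  map_smul' s z := by
    induction z using TensorProduct.induction_on with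
    | zero => simp only [smul_zero, map_zero]
    | add x y hx hy => simp only [smul_add, map_add, hx, hy]
    | tmul x y =>
      induction s using TensorProduct.induction_on with
      | zero => simp only [zero_smul, map_zero]
      | add a b ha hb => simp only [add_smul, map_add, ha, hb]
      | tmul a b =>
        simp only [tensorModule_smul_tmul, TensorProduct.map_tmul, LinearMap.restrictScalars_apply,
          map_smul, RingHom.id_apply]

lemma tensorMap_tmul (f : P →ₗ[R1] P') (g : Q →ₗ[R2] Q') (x : P) (y : Q) :
    tensorMap (k := k) f g (x ⊗ₜ y) = f x ⊗ₜ g y := rfl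

lemma tensorHom_ext {T : Type} [AddCommGroup T] [Module (R1 ⊗[k] R2) T]
    {f g : P ⊗[k] Q →ₗ[R1 ⊗[k] R2] T} (h : ∀ x y, f (x ⊗ₜ y) = g (x ⊗ₜ y)) : f = g := by
  ext z
  induction z using TensorProduct.induction_on with
  | zero => simp only [map_zero]
  | add x y hx hy => simp only [map_add, hx, hy]
  | tmul x y => exact h x y

variable (k P P' Q Q') in
/-- `tensorMap` as a linear map on the tensor product of Hom modules. -/
noncomputable def homTensorHom :
    (P →ₗ[R1] P') ⊗[k] (Q →ₗ[R2] Q') →ₗ[k] (P ⊗[k] Q →ₗ[R1 ⊗[k] R2] P' ⊗[k] Q') :=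
  TensorProduct.lift (LinearMap.mk₂ k tensorMap
    (fun f f' g => tensorHom_ext fun x y => by
      simp only [tensorMap_tmul, LinearMap.add_apply, TensorProduct.add_tmul])
    (fun c f g => tensorHom_ext fun x y => by
      simp only [tensorMap_tmul, LinearMap.smul_apply, smul_tmul'])
    (fun f g g' => tensorHom_ext fun x y => by
      simp only [tensorMap_tmul, LinearMap.add_apply, TensorProduct.tmul_add])
    (fun c f g => tensorHom_ext fun x y => by
      simp only [tensorMap_tmul, LinearMap.smul_apply, TensorProduct.tmul_smul]))

lemma homTensorHom_tmul (f : P →ₗ[R1] P') (g : Q →ₗ[R2] Q') :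
    homTensorHom k P P' Q Q' (f ⊗ₜ g) = tensorMap f g := rfl

end

section Free

variable {m l : ℕ}

variable (k R1 R2) in
/-- The coordinate functions of the tensor product of two standard free modules. -/
noncomputable def tensorCoord (i : Fin m) (j : Fin l) :
    (Fin m → R1) ⊗[k] (Fin l → R2) →ₗ[R1 ⊗[k] R2] R1 ⊗[k] R2 where
  toFun := TensorProduct.map (LinearMap.proj i) (LinearMap.proj j)
  map_add' := map_add _
  map_smul' s z := by
    induction z using TensorProduct.induction_on with
    | zero => simp only [smul_zero, map_zero]
    | add x y hx hy => simp only [smul_add, map_add, hx, hy]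
    | tmul x y =>
      induction s using TensorProduct.induction_on with
      | zero => simp only [zero_smul, map_zero]
      | add a b ha hb => simp only [add_smul, map_add, ha, hb]
      | tmul a b =>
        simp [tensorModule_smul_tmul]

lemma tensorCoord_tmul (i : Fin m) (j : Fin l) (x : Fin m → R1) (y : Fin l → R2) :
    tensorCoord k R1 R2 i j (x ⊗ₜ y) = x i ⊗ₜ y j := rfl

lemma sum_tensorCoord (z : (Fin m → R1) ⊗[k] (Fin l → R2)) :
    ∑ ij : Fin m × Fin l, tensorCoord k R1 R2 ij.1 ij.2 z •
      ((Pi.single ij.1 1 : Fin m → R1) ⊗ₜ[k] (Pi.single ij.2 1 : Fin l → R2)) = z := by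
  induction z using TensorProduct.induction_on with
  | zero => simp only [map_zero, zero_smul, Finset.sum_const_zero]
  | add x y hx hy => simp only [map_add, add_smul, Finset.sum_add_distrib, hx, hy]
  | tmul x y =>
    conv_rhs => rw [pi_eq_sum_univ' x, pi_eq_sum_univ' y]
    simp only [tensorCoord_tmul, tensorModule_smul_tmul, Fintype.sum_prod_type,
      TensorProduct.sum_tmul, TensorProduct.tmul_sum]
    rw [Finset.sum_comm]

instance tensor_free_projective :
    Module.Projective (R1 ⊗[k] R2) ((Fin m → R1) ⊗[k] (Fin l → R2)) := by
  refine Module.Projective.of_split (M := Fin m × Fin l → R1 ⊗[k] R2)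
    (LinearMap.pi fun ij => tensorCoord k R1 R2 ij.1 ij.2)
    (∑ ij : Fin m × Fin l, (LinearMap.proj ij).smulRight
      ((Pi.single ij.1 1 : Fin m → R1) ⊗ₜ[k] (Pi.single ij.2 1 : Fin l → R2))) ?_
  ext z
  simpa using sum_tensorCoord z

variable (M1 M2 : Type) [AddCommGroup M1] [Module k M1] [Module R1 M1] [IsScalarTower k R1 M1]
  [AddCommGroup M2] [Module k M2] [Module R2 M2] [IsScalarTower k R2 M2]

/-- The map sending `x` to the morphism with value `x` on the `i`-th basis vector and zero on the
others. -/
def coordHom (k : Type) [CommRing k] {R : Type} [CommRing R] [Algebra k R] (M : Type)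
    [AddCommGroup M] [Module k M] [Module R M] [IsScalarTower k R M] {m : ℕ} (i : Fin m) :
    M →ₗ[k] ((Fin m → R) →ₗ[R] M) where
  toFun x := (LinearMap.proj i : (Fin m → R) →ₗ[R] R).smulRight x
  map_add' x y := by ext; simp
  map_smul' c x := LinearMap.ext fun y => smul_comm (y i) c x

lemma sum_coordHom {R : Type} [CommRing R] [Algebra k R] {M : Type}
    [AddCommGroup M] [Module k M] [Module R M] [IsScalarTower k R M] (f : (Fin m → R) →ₗ[R] M) :
    ∑ i, coordHom k M i (f (Pi.single i 1)) = f := by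
  ext i
  simp [coordHom, Pi.single_apply]

lemma homTensorHom_coordHom (i : Fin m) (j : Fin l) (w : M1 ⊗[k] M2)
    (z : (Fin m → R1) ⊗[k] (Fin l → R2)) :
    homTensorHom k _ M1 _ M2 (TensorProduct.map (coordHom k M1 i) (coordHom k M2 j) w) z =
      tensorCoord k R1 R2 i j z • w := by
  induction w using TensorProduct.induction_on with
  | zero => simp only [map_zero, smul_zero, LinearMap.zero_apply]
  | add x y hx hy => simp only [map_add, smul_add, LinearMap.add_apply, hx, hy]
  | tmul a b =>
    induction z using TensorProduct.induction_on with
    | zero => simp only [map_zero, zero_smul]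
    | add x y hx hy => simp only [map_add, add_smul, hx, hy]
    | tmul x y => rfl

/-- The tensor product of Hom modules out of finite free modules. -/
noncomputable def homTensorEquiv (m l : ℕ) :
    ((Fin m → R1) →ₗ[R1] M1) ⊗[k] ((Fin l → R2) →ₗ[R2] M2) ≃ₗ[k]
      ((Fin m → R1) ⊗[k] (Fin l → R2) →ₗ[R1 ⊗[k] R2] M1 ⊗[k] M2) :=
  LinearEquiv.ofBijective (homTensorHom k _ _ _ _) <| by
    refine Function.bijective_iff_has_inverse.2 ⟨fun f => ∑ ij : Fin m × Fin l,
      TensorProduct.map (coordHom k M1 ij.1) (coordHom k M2 ij.2)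
        (f (Pi.single ij.1 1 ⊗ₜ Pi.single ij.2 1)), fun z => ?_, fun f => ?_⟩
    · induction z using TensorProduct.induction_on with
      | zero => simp only [map_zero, LinearMap.zero_apply, Finset.sum_const_zero]
      | add x y hx hy =>
        simp only [map_add, LinearMap.add_apply, Finset.sum_add_distrib, hx, hy]
      | tmul f g =>
        simp only [homTensorHom_tmul, tensorMap_tmul, TensorProduct.map_tmul]
        conv_rhs => rw [← sum_coordHom (k := k) f, ← sum_coordHom (k := k) g]
        simp only [Fintype.sum_prod_type, TensorProduct.sum_tmul, TensorProduct.tmul_sum]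
        rw [Finset.sum_comm]
    · ext z
      conv_rhs => rw [← sum_tensorCoord z]
      simp only [map_sum, map_smul, LinearMap.sum_apply, homTensorHom_coordHom]

end Free

end TensorHom

lemma exists_finite_free_resolution (R : Type) [CommRing R] [IsNoetherianRing R] (N : Type)
    [AddCommGroup N] [Module R N] [Module.Finite R N] :
    ∃ (m : ℕ → ℕ) (d : ∀ i, (Fin (m (i + 1)) → R) →ₗ[R] (Fin (m i) → R))
      (ε : (Fin (m 0) → R) →ₗ[R] N), (∀ i, Function.Exact (d (i + 1)) (d i)) ∧
      Function.Surjective ε ∧ Function.Exact (d 0) ε := by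
  have step : ∀ (a : ℕ) (T : Type) [AddCommGroup T] [Module R T] (f : (Fin a → R) →ₗ[R] T),
      ∃ (c : ℕ) (g : (Fin c → R) →ₗ[R] (Fin a → R)), Function.Exact g f := by
    intro a T _ _ f
    obtain ⟨c, g, hg⟩ := Module.Finite.exists_fin' R (LinearMap.ker f)
    refine ⟨c, (LinearMap.ker f).subtype ∘ₗ g, LinearMap.exact_iff.2 ?_⟩
    rw [LinearMap.range_comp, LinearMap.range_eq_top.2 hg, Submodule.map_top,
      Submodule.range_subtype]
  obtain ⟨m₀, ε, hε⟩ := Module.Finite.exists_fin' R N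
  obtain ⟨m₁, d₀, h₀⟩ := step m₀ N ε
  choose c g hg using fun s : Σ (a : ℕ) (b : ℕ), ((Fin a → R) →ₗ[R] (Fin b → R)) =>
    step s.1 _ s.2.2
  let s : ℕ → Σ (a : ℕ) (b : ℕ), ((Fin a → R) →ₗ[R] (Fin b → R)) := fun n =>
    Nat.rec ⟨m₁, m₀, d₀⟩ (fun _ t => ⟨c t, t.1, g t⟩) n
  exact ⟨fun i => (s i).2.1, fun i => (s i).2.2, ε, fun i => hg (s i), hε, h₀⟩

/-- There are finitely many pairs of natural numbers with a given sum. -/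
instance fintypeTotalDegree (n : ℕ) : Fintype {pq : ℕ × ℕ // pq.1 + pq.2 = n} :=
  Fintype.subtype (Finset.HasAntidiagonal.antidiagonal n) fun _ =>
    Finset.HasAntidiagonal.mem_antidiagonal

section Adjoint

variable {k S : Type} [CommRing k] [CommRing S] [Algebra k S] {X Z : ℕ → ℕ → Type}
  [∀ i j, AddCommGroup (X i j)] [∀ i j, Module k (X i j)] [∀ i j, AddCommGroup (Z i j)]
  [∀ i j, Module S (Z i j)] {T : Type} [AddCommGroup T] [Module k T] [Module S T]
  [IsScalarTower k S T]

lemma sum_totUp {b₁ : ∀ i j, X i j →ₗ[k] X (i + 1) j} {b₂ : ∀ i j, X i j →ₗ[k] X i (j + 1)}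
    {a₁ : ∀ i j, Z (i + 1) j →ₗ[S] Z i j} {a₂ : ∀ i j, Z i (j + 1) →ₗ[S] Z i j}
    (F : ∀ i j, X i j →ₗ[k] (Z i j →ₗ[S] T))
    (h₁ : ∀ i j x z, F (i + 1) j (b₁ i j x) z = F i j x (a₁ i j z))
    (h₂ : ∀ i j x z, F i (j + 1) (b₂ i j x) z = F i j x (a₂ i j z)) {n : ℕ} (x : Tot X n)
    (z : Tot Z (n + 1)) :
    ∑ pq, F _ _ (totUp b₁ b₂ n x pq) (z pq) = ∑ pq, F _ _ (x pq) (totDown a₁ a₂ n z pq) := by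
  have e₁ : ∑ pq : {pq : ℕ × ℕ // pq.1 + pq.2 = n}, F _ _ (x pq)
        (a₁ _ _ (z ⟨(pq.1.1 + 1, pq.1.2), by have := pq.2; omega⟩)) =
      ∑ pq : {pq : ℕ × ℕ // pq.1 + pq.2 = n + 1},
        F _ _ (totUpFst b₁ n pq.1.1 pq.1.2 pq.2 x) (z pq) := by
    refine Fintype.sum_of_injective (fun pq => ⟨(pq.1.1 + 1, pq.1.2), by have := pq.2; omega⟩)
      (fun pq pq' h => ?_) _ _ ?_ fun pq => (h₁ _ _ _ _).symm
    · simpa [Subtype.ext_iff, Prod.ext_iff] using h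
    · rintro ⟨⟨_ | p, q⟩, hpq⟩ h
      · simp [totUpFst]
      · exact (h ⟨⟨(p, q), by simp only at hpq; omega⟩, rfl⟩).elim
  have e₂ : ∑ pq : {pq : ℕ × ℕ // pq.1 + pq.2 = n}, F _ _ (x pq)
        (a₂ _ _ (z ⟨(pq.1.1, pq.1.2 + 1), by have := pq.2; omega⟩)) =
      ∑ pq : {pq : ℕ × ℕ // pq.1 + pq.2 = n + 1},
        F _ _ (totUpSnd b₂ n pq.1.1 pq.1.2 pq.2 x) (z pq) := by
    refine Fintype.sum_of_injective (fun pq => ⟨(pq.1.1, pq.1.2 + 1), by have := pq.2; omega⟩)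
      (fun pq pq' h => ?_) _ _ ?_ fun pq => (h₂ _ _ _ _).symm
    · simpa [Subtype.ext_iff, Prod.ext_iff] using h
    · rintro ⟨⟨p, _ | q⟩, hpq⟩ h
      · simp [totUpSnd]
      · exact (h ⟨⟨(p, q), by simp only at hpq; omega⟩, rfl⟩).elim
  have e₃ : ∀ pq, F _ _ (totUp b₁ b₂ n x pq) (z pq) =
      F _ _ (totUpFst b₁ n pq.1.1 pq.1.2 pq.2 x) (z pq) +
        F _ _ (totUpSnd b₂ n pq.1.1 pq.1.2 pq.2 x) (z pq) := fun pq => by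
    rw [← LinearMap.add_apply, ← map_add]
    rfl
  have e₄ : ∀ pq, F _ _ (x pq) (totDown a₁ a₂ n z pq) =
      F _ _ (x pq) (a₁ _ _ (z ⟨(pq.1.1 + 1, pq.1.2), by have := pq.2; omega⟩)) +
        F _ _ (x pq) (a₂ _ _ (z ⟨(pq.1.1, pq.1.2 + 1), by have := pq.2; omega⟩)) := fun pq => by
    rw [← map_add]
    rfl
  simp only [e₃, e₄, Finset.sum_add_distrib, e₁, e₂]

end Adjoint

section TensorResolution

variable {k : Type} [Field k] {R1 R2 : Type} [CommRing R1] [CommRing R2] [Algebra k R1]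
  [Algebra k R2]

/-- The differential of the tensor product of two chain complexes of finite free modules. -/
noncomputable def tensorDiff {m l : ℕ → ℕ} (d : ∀ i, (Fin (m (i + 1)) → R1) →ₗ[R1] (Fin (m i) → R1))
    (d' : ∀ i, (Fin (l (i + 1)) → R2) →ₗ[R2] (Fin (l i) → R2)) (n : ℕ) :
    Tot (fun i j => (Fin (m i) → R1) ⊗[k] (Fin (l j) → R2)) (n + 1) →ₗ[R1 ⊗[k] R2]
      Tot (fun i j => (Fin (m i) → R1) ⊗[k] (Fin (l j) → R2)) n :=
  totDown (fun i _ => tensorMap (d i) LinearMap.id)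
    (fun i j => (-1 : ℤ) ^ i • tensorMap LinearMap.id (d' j)) n

section

variable {N1 N2 : Type} [AddCommGroup N1] [Module k N1] [Module R1 N1] [IsScalarTower k R1 N1]
  [AddCommGroup N2] [Module k N2] [Module R2 N2] [IsScalarTower k R2 N2] {m l : ℕ → ℕ}
  {d : ∀ i, (Fin (m (i + 1)) → R1) →ₗ[R1] (Fin (m i) → R1)} {ε : (Fin (m 0) → R1) →ₗ[R1] N1}
  (hd : ∀ i, Function.Exact (d (i + 1)) (d i)) (hε : Function.Surjective ε)
  (h0 : Function.Exact (d 0) ε)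
  {d' : ∀ i, (Fin (l (i + 1)) → R2) →ₗ[R2] (Fin (l i) → R2)} {ε' : (Fin (l 0) → R2) →ₗ[R2] N2}
  (hd' : ∀ i, Function.Exact (d' (i + 1)) (d' i)) (hε' : Function.Surjective ε')
  (h0' : Function.Exact (d' 0) ε')

/-- The augmentation of the tensor product of two augmented complexes. -/
noncomputable def tensorAugmentation (ε : (Fin (m 0) → R1) →ₗ[R1] N1)
    (ε' : (Fin (l 0) → R2) →ₗ[R2] N2) :
    Tot (fun i j => (Fin (m i) → R1) ⊗[k] (Fin (l j) → R2)) 0 →ₗ[R1 ⊗[k] R2] N1 ⊗[k] N2 :=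
  tensorMap ε ε' ∘ₗ LinearMap.proj (φ := fun pq : {pq : ℕ × ℕ // pq.1 + pq.2 = 0} =>
    (Fin (m pq.1.1) → R1) ⊗[k] (Fin (l pq.1.2) → R2)) ⟨(0, 0), rfl⟩

include hε hε' in
lemma tensorAugmentation_surjective :
    Function.Surjective (tensorAugmentation (k := k) (m := m) (l := l) ε ε') := by
  intro y
  obtain ⟨x, hx⟩ := TensorProduct.map_surjective (g := ε.restrictScalars k)
    (g' := ε'.restrictScalars k) hε hε' y
  have key : ∀ pq : {pq : ℕ × ℕ // pq.1 + pq.2 = 0}, pq = ⟨(0, 0), rfl⟩ := by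
    rintro ⟨⟨p, q⟩, h⟩
    simp only at h
    simp only [Subtype.mk.injEq, Prod.mk.injEq]
    omega
  exact ⟨fun pq => (key pq).symm ▸ x, hx⟩

include hd hε h0 hd' hε' h0'

lemma tensorDiff_exact (n : ℕ) :
    Function.Exact (tensorDiff (k := k) d d' (n + 1)) (tensorDiff (k := k) d d' n) :=
  chainDiff_exact_succ (P := fun i => Fin (m i) → R1) (Q := fun i => Fin (l i) → R2)
    (d := fun i => (d i).restrictScalars k) (ε := ε.restrictScalars k) hd hε h0
    (d' := fun i => (d' i).restrictScalars k) (ε' := ε'.restrictScalars k) hd' hε' h0' n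

lemma tensorDiff_exact_tensorAugmentation :
    Function.Exact (tensorDiff (k := k) d d' 0) (tensorAugmentation (k := k) ε ε') :=
  chainDiff_exact_zero (P := fun i => Fin (m i) → R1) (Q := fun i => Fin (l i) → R2)
    (d := fun i => (d i).restrictScalars k) (ε := ε.restrictScalars k) hd hε h0
    (d' := fun i => (d' i).restrictScalars k) (ε' := ε'.restrictScalars k) hd' hε' h0'

end

end TensorResolution

lemma lcomp_lcomp_eq_zero {k R P P' P'' : Type} [CommRing k] [CommRing R] [Algebra k R]
    [AddCommGroup P] [Module R P] [AddCommGroup P'] [Module R P'] [AddCommGroup P''] [Module R P'']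
    {f : P →ₗ[R] P'} {g : P' →ₗ[R] P''} (h : Function.Exact f g) (M : Type) [AddCommGroup M]
    [Module k M] [Module R M] [IsScalarTower k R M] (φ : P'' →ₗ[R] M) :
    LinearMap.lcomp k M f (LinearMap.lcomp k M g φ) = 0 := by
  ext x
  simp [h.apply_apply_eq_zero]

section HomTotal

variable {k : Type} [Field k] {R1 R2 : Type} [CommRing R1] [CommRing R2] [Algebra k R1]
  [Algebra k R2] (M1 M2 : Type) [AddCommGroup M1] [Module k M1] [Module R1 M1]
  [IsScalarTower k R1 M1] [AddCommGroup M2] [Module k M2] [Module R2 M2] [IsScalarTower k R2 M2]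

variable (k R1 R2) in
/-- Maps out of the tensor product of two complexes of finite free modules, in degree `n`. -/
noncomputable def homTotEquiv (m l : ℕ → ℕ) (n : ℕ) :
    Tot (fun i j => ((Fin (m i) → R1) →ₗ[R1] M1) ⊗[k] ((Fin (l j) → R2) →ₗ[R2] M2)) n ≃ₗ[k]
      (Tot (fun i j => (Fin (m i) → R1) ⊗[k] (Fin (l j) → R2)) n →ₗ[R1 ⊗[k] R2] M1 ⊗[k] M2) :=
  LinearEquiv.piCongrRight (fun pq : {pq : ℕ × ℕ // pq.1 + pq.2 = n} =>
      homTensorEquiv M1 M2 (m pq.1.1) (l pq.1.2)) ≪≫ₗ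
    LinearMap.lsum (R1 ⊗[k] R2) (fun pq : {pq : ℕ × ℕ // pq.1 + pq.2 = n} =>
      (Fin (m pq.1.1) → R1) ⊗[k] (Fin (l pq.1.2) → R2)) k

lemma homTotEquiv_apply {m l : ℕ → ℕ} {n : ℕ} (x) (z) :
    homTotEquiv k R1 R2 M1 M2 m l n x z =
      ∑ pq : {pq : ℕ × ℕ // pq.1 + pq.2 = n}, homTensorHom k _ _ _ _ (x pq) (z pq) := by
  simp [homTotEquiv, LinearMap.lsum_apply, homTensorEquiv]

lemma homTotEquiv_totUp {m l : ℕ → ℕ} (d : ∀ i, (Fin (m (i + 1)) → R1) →ₗ[R1] (Fin (m i) → R1))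
    (d' : ∀ i, (Fin (l (i + 1)) → R2) →ₗ[R2] (Fin (l i) → R2)) (n : ℕ)
    (x : Tot (fun i j => ((Fin (m i) → R1) →ₗ[R1] M1) ⊗[k] ((Fin (l j) → R2) →ₗ[R2] M2)) n) :
    homTotEquiv k R1 R2 M1 M2 m l (n + 1)
      (totUp (X := fun i j => ((Fin (m i) → R1) →ₗ[R1] M1) ⊗[k] ((Fin (l j) → R2) →ₗ[R2] M2))
        (fun i _ => TensorProduct.map (LinearMap.lcomp k M1 (d i)) LinearMap.id)
        (fun i j => signedMap i LinearMap.id (LinearMap.lcomp k M2 (d' j))) n x) =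
      LinearMap.lcomp k (M1 ⊗[k] M2) (tensorDiff d d' n) (homTotEquiv k R1 R2 M1 M2 m l n x) := by
  refine LinearMap.ext fun z => ?_
  rw [LinearMap.lcomp_apply', LinearMap.comp_apply, homTotEquiv_apply, homTotEquiv_apply,
    tensorDiff]
  refine sum_totUp (fun i j => homTensorHom k (Fin (m i) → R1) M1 (Fin (l j) → R2) M2)
    (fun i j w y => ?_) (fun i j w y => ?_) x z
  · induction w using TensorProduct.induction_on with
    | zero => simp only [map_zero, LinearMap.zero_apply]
    | add f g hf hg => simp only [map_add, LinearMap.add_apply, hf, hg]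
    | tmul f g =>
      induction y using TensorProduct.induction_on with
      | zero => simp only [map_zero]
      | add a b ha hb => simp only [map_add, ha, hb]
      | tmul a b => rfl
  · induction w using TensorProduct.induction_on with
    | zero => simp only [map_zero, LinearMap.zero_apply]
    | add f g hf hg => simp only [map_add, LinearMap.add_apply, hf, hg]
    | tmul f g =>
      induction y using TensorProduct.induction_on with
      | zero => simp only [map_zero]
      | add a b ha hb => simp only [map_add, ha, hb]
      | tmul a b =>
        have e : ((-1 : ℤ) ^ i • tensorMap (LinearMap.id : (Fin (m i) → R1) →ₗ[R1] _) (d' j))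
          (a ⊗ₜ[k] b) = (-1 : ℤ) ^ i • (a ⊗ₜ[k] d' j b) := rfl
        refine Eq.trans ?_ (congrArg (homTensorHom k _ M1 _ M2 (f ⊗ₜ g)) e.symm)
        rw [signedMap_tmul]
        rcases neg_one_pow_eq_or ℤ i with h | h
        · simp only [h, one_smul]
          rfl
        · simp only [h, neg_smul, one_smul, map_neg, LinearMap.neg_apply]
          rfl

end HomTotal

/-- The Künneth formula over a field, with cohomology carried by additive monoids. -/
lemma HasCohomology.nonempty_equiv_directSum {k : Type} [Field k] {A B E F C : ℕ → Type}
    [∀ i, AddCommGroup (A i)] [∀ i, Module k (A i)] [∀ i, AddCommGroup (B i)]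
    [∀ i, Module k (B i)] [∀ i, AddCommMonoid (E i)] [∀ i, Module k (E i)]
    [∀ i, AddCommMonoid (F i)] [∀ i, Module k (F i)] [∀ i, AddCommGroup (C i)]
    [∀ i, Module k (C i)] {δ : ∀ n, A n →ₗ[k] A (n + 1)} (hδ : ∀ n x, δ (n + 1) (δ n x) = 0)
    (hE : ∀ n, HasCohomology δ n (E n)) {δ' : ∀ n, B n →ₗ[k] B (n + 1)}
    (hδ' : ∀ n x, δ' (n + 1) (δ' n x) = 0) (hF : ∀ n, HasCohomology δ' n (F n))
    {γ : ∀ n, C n →ₗ[k] C (n + 1)} (e : ∀ n, Tot (fun i j => A i ⊗[k] B j) n ≃ₗ[k] C n)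
    (he : ∀ n x, e (n + 1) (totUp (X := fun i j => A i ⊗[k] B j)
      (fun i j => TensorProduct.map (δ i) (LinearMap.id : B j →ₗ[k] B j))
      (fun i j => signedMap i (LinearMap.id : A i →ₗ[k] A i) (δ' j)) n x) = γ n (e n x))
    {n : ℕ} {G : Type} [AddCommMonoid G] [Module k G] (hG : HasCohomology γ n G) :
    Nonempty (G ≃ₗ[k] DirectSum {pq : ℕ × ℕ // pq.1 + pq.2 = n}
      fun pq => E pq.1.1 ⊗[k] F pq.1.2) := by
  let _ : ∀ i, AddCommGroup (E i) := fun i => Module.addCommMonoidToAddCommGroup k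
  let _ : ∀ i, AddCommGroup (F i) := fun i => Module.addCommMonoidToAddCommGroup k
  obtain ⟨f⟩ := hG.nonempty_equiv ((HasCohomology.tensor hδ hE hδ' hF n).of_equiv e he)
  exact ⟨f ≪≫ₗ (DirectSum.linearEquivFunOnFintype k {pq : ℕ × ℕ // pq.1 + pq.2 = n}
    fun pq => E pq.1.1 ⊗[k] F pq.1.2).symm⟩

open TensorProduct DirectSum in
/-- Let `k` be a field, `R1`, `R2` commutative noetherian `k`-algebras, `N1` a finitely
generated `R1`-module, `N2` a finitely generated `R2`-module, `M1` an `R1`-module and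
`M2` an `R2`-module.  For every `n ≥ 0` there is an isomorphism of `k`-vector spaces
`Ext^n_{R1 ⊗ R2}(N1 ⊗ N2, M1 ⊗ M2) ≅ ⊕_{p+q=n} Ext^p_{R1}(N1,M1) ⊗ Ext^q_{R2}(N2,M2)`. -/
theorem ext_tensorProduct_kunneth
    (k : Type) [Field k] (R1 R2 : Type) [CommRing R1] [CommRing R2]
    [Algebra k R1] [Algebra k R2] [IsNoetherianRing R1] [IsNoetherianRing R2]
    (N1 M1 : Type) [AddCommGroup N1] [Module k N1] [Module R1 N1] [IsScalarTower k R1 N1]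
    [AddCommGroup M1] [Module k M1] [Module R1 M1] [IsScalarTower k R1 M1]
    (N2 M2 : Type) [AddCommGroup N2] [Module k N2] [Module R2 N2] [IsScalarTower k R2 N2]
    [AddCommGroup M2] [Module k M2] [Module R2 M2] [IsScalarTower k R2 M2]
    [Module.Finite R1 N1] [Module.Finite R2 N2]
    (n : ℕ) :
    Nonempty (
      (RestrictScalars k (R1 ⊗[k] R2)
          (extGroup (R1 ⊗[k] R2) (N1 ⊗[k] N2) (M1 ⊗[k] M2) n)) ≃ₗ[k]
        (⨁ pq : {pq : ℕ × ℕ // pq.1 + pq.2 = n},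
          (RestrictScalars k R1 (extGroup R1 N1 M1 pq.1.1)) ⊗[k]
            (RestrictScalars k R2 (extGroup R2 N2 M2 pq.1.2)))) := by
  obtain ⟨m, d, ε, hd, hε, h0⟩ := exists_finite_free_resolution R1 N1
  obtain ⟨l, d', ε', hd', hε', h0'⟩ := exists_finite_free_resolution R2 N2
  have (i : ℕ) : Module.Projective (R1 ⊗[k] R2)
      (Tot (fun i j => (Fin (m i) → R1) ⊗[k] (Fin (l j) → R2)) i) :=
    .of_equiv (DirectSum.linearEquivFunOnFintype (R1 ⊗[k] R2)
      {pq : ℕ × ℕ // pq.1 + pq.2 = i} fun pq => (Fin (m pq.1.1) → R1) ⊗[k] (Fin (l pq.1.2) → R2))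
  have hT := hasCohomology_extGroup (tensorDiff (k := k) d d')
    (tensorDiff_exact hd hε h0 hd' hε' h0') (tensorAugmentation ε ε')
    (tensorAugmentation_surjective hε hε')
    (tensorDiff_exact_tensorAugmentation hd hε h0 hd' hε' h0') (M1 ⊗[k] M2) k n
  exact HasCohomology.nonempty_equiv_directSum
    (A := fun i => (Fin (m i) → R1) →ₗ[R1] M1) (B := fun i => (Fin (l i) → R2) →ₗ[R2] M2)
    (E := fun i => RestrictScalars k R1 (extGroup R1 N1 M1 i))
    (F := fun i => RestrictScalars k R2 (extGroup R2 N2 M2 i))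
    (fun i => lcomp_lcomp_eq_zero (hd i) M1)
    (fun i => hasCohomology_extGroup (P := fun i => Fin (m i) → R1) d hd ε hε h0 M1 k i)
    (fun i => lcomp_lcomp_eq_zero (hd' i) M2)
    (fun i => hasCohomology_extGroup (P := fun i => Fin (l i) → R2) d' hd' ε' hε' h0' M2 k i)
    (homTotEquiv k R1 R2 M1 M2 m l) (homTotEquiv_totUp M1 M2 d d') hT
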